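/- Let (R,μ) be a non-atomic measure space with 0 < μ(R) < ∞, let B be a Young function, and let 1 < r < s ≤ ∞. Then the continuous embedding L^{r,s} ↪ L^B holds (i.e. there is C > 0 with ‖f‖_B ≤ C‖f‖_{r,s} for all f) if and only if the almost-compact embedding L^{r,s} ↪* L^B holds. -/

import Mathlib

open MeasureTheory Filter Set ENNReal

noncomputable section

/-- A Young function: a convex, non-decreasing, left-continuous function
`A : [0,∞] → [0,∞]` with `A(0) = 0`, `A(0+) = 0` and `A(∞) = ∞`. -/
structure YoungFunction where
  toFun : ℝ≥0∞ → ℝ≥0∞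
  map_zero : toFun 0 = 0
  tendsto_zero : Filter.Tendsto toFun (nhdsWithin 0 (Set.Ioi 0)) (nhds 0)
  mono : Monotone toFun
  convex' : ∀ s t c : ℝ≥0∞, c ≤ 1 →
    toFun (c * s + (1 - c) * t) ≤ c * toFun s + (1 - c) * toFun t
  left_continuous : ∀ t : ℝ≥0∞, 0 < t → toFun t = ⨆ s ∈ Set.Iio t, toFun s
  map_top : toFun ⊤ = ⊤

/-- Left-continuous inverse of a non-decreasing function `F : [0,∞] → [0,∞]`:
`F⁻¹(t) = inf {τ ≥ 0 : F(τ) ≥ t}`. -/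
def leftInvE (F : ℝ≥0∞ → ℝ≥0∞) (t : ℝ≥0∞) : ℝ≥0∞ :=
  sInf {τ : ℝ≥0∞ | t ≤ F τ}

/-- `a` is the right-continuous derivative of the Young function `A`:
`a` is non-decreasing, right-continuous, `a(∞) = ∞`, and
`A(t) = ∫₀ᵗ a(s) ds` for all finite `t ≥ 0`. -/
def IsYoungDerivative (A : YoungFunction) (a : ℝ≥0∞ → ℝ≥0∞) : Prop :=
  Monotone a ∧ a ⊤ = ⊤ ∧
    (∀ t : ℝ≥0∞, t ≠ ⊤ → Filter.Tendsto a (nhdsWithin t (Set.Ioi t)) (nhds (a t))) ∧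
    ∀ t : ℝ, 0 ≤ t →
      A.toFun (ENNReal.ofReal t) = ∫⁻ s in Set.Ioc (0:ℝ) t, a (ENNReal.ofReal s)

/-- The Young conjugate `B̃(t) = sup {s·t − B(s) : s ∈ [0,∞]}`. -/
def youngConj (A : YoungFunction) (t : ℝ≥0∞) : ℝ≥0∞ :=
  ⨆ s : ℝ≥0∞, s * t - A.toFun s

variable {R : Type*} [MeasurableSpace R]

/-- The distribution function `f₊(λ) = μ({x : |f(x)| > λ})`. -/
def distFn (μ : Measure R) (f : R → ℝ) (lam : ℝ≥0∞) : ℝ≥0∞ :=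
  μ {x | lam < ENNReal.ofReal |f x|}

/-- The non-increasing rearrangement `f*(t) = inf {λ ≥ 0 : f₊(λ) ≤ t}`. -/
def rearr (μ : Measure R) (f : R → ℝ) (t : ℝ≥0∞) : ℝ≥0∞ :=
  sInf {lam : ℝ≥0∞ | distFn μ f lam ≤ t}

/-- The Lorentz functional `‖f‖_{p,q}` for `p, q ∈ (0,∞]`. -/
def lorentzNorm (μ : Measure R) (p q : ℝ≥0∞) (f : R → ℝ) : ℝ≥0∞ :=
  if q = ⊤ then
    ⨆ t : Set.Ioi (0:ℝ), ENNReal.ofReal t.1 ^ (p⁻¹).toReal * rearr μ f (ENNReal.ofReal t.1)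
  else
    (∫⁻ t in Set.Ioi (0:ℝ),
        (ENNReal.ofReal t ^ (p⁻¹).toReal * rearr μ f (ENNReal.ofReal t)) ^ q.toReal
          / ENNReal.ofReal t) ^ (q⁻¹).toReal

/-- The Luxemburg norm `‖f‖_A = inf {λ > 0 : ∫ A(|f|/λ) dμ ≤ 1}`. -/
def luxNorm (μ : Measure R) (A : YoungFunction) (f : R → ℝ) : ℝ≥0∞ :=
  sInf {lam : ℝ≥0∞ | 0 < lam ∧ ∫⁻ x, A.toFun (ENNReal.ofReal |f x| / lam) ∂μ ≤ 1}

/-- The measure `μ` is non-atomic: every set of positive measure has a subset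
of strictly smaller positive measure. -/
def NonAtomic (μ : Measure R) : Prop :=
  ∀ s : Set R, MeasurableSet s → 0 < μ s →
    ∃ t, t ⊆ s ∧ MeasurableSet t ∧ 0 < μ t ∧ μ t < μ s

/-- The almost-compact embedding `X ↪* Y`, for (quasi)norm functionals `NX`, `NY`:
`X ⊂ Y` and for every sequence of measurable sets `Eₙ` whose characteristic
functions tend to `0` a.e., `sup_{‖f‖_X ≤ 1} ‖f χ_{Eₙ}‖_Y → 0`. -/
def AlmostCompactEmbedding (μ : Measure R) (NX NY : (R → ℝ) → ℝ≥0∞) : Prop :=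
  (∀ f : R → ℝ, Measurable f → NX f < ⊤ → NY f < ⊤) ∧
    ∀ E : ℕ → Set R, (∀ n, MeasurableSet (E n)) →
      (∀ᵐ x ∂μ, Filter.Tendsto (fun n => (E n).indicator (fun _ => (1:ℝ)) x)
        Filter.atTop (nhds 0)) →
      Filter.Tendsto
        (fun n => ⨆ f : {f : R → ℝ // Measurable f ∧ NX f ≤ 1},
          NY ((E n).indicator f.1)) Filter.atTop (nhds 0)

/-- The continuous embedding `X ↪ Y`: there is `C > 0` with `‖f‖_Y ≤ C ‖f‖_X`. -/
def NormEmbedding (μ : Measure R) (NX NY : (R → ℝ) → ℝ≥0∞) : Prop :=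
  ∃ C : ℝ, 0 < C ∧ ∀ f : R → ℝ, Measurable f → NY f ≤ ENNReal.ofReal C * NX f

section NonAtomic

variable {μ : Measure R}

lemma NonAtomic.exists_subset_measure_le_half (hna : NonAtomic μ) {A : Set R}
    (hA : MeasurableSet A) (hA0 : 0 < μ A) :
    ∃ D ⊆ A, MeasurableSet D ∧ 0 < μ D ∧ μ D ≤ μ A / 2 := by
  obtain ⟨t, htA, ht, ht0, htlt⟩ := hna A hA hA0
  have hadd : μ t + μ (A \ t) = μ A := by
    rw [measure_sdiff htA ht.nullMeasurableSet htlt.ne_top, add_tsub_cancel_of_le htlt.le]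
  by_cases h : μ t ≤ μ A / 2
  · exact ⟨t, htA, ht, ht0, h⟩
  · refine ⟨A \ t, sdiff_subset, hA.diff ht, ?_, ?_⟩
    · rw [pos_iff_ne_zero]
      intro h0
      rw [h0, add_zero] at hadd
      exact htlt.ne hadd
    · by_contra! h'
      have := ENNReal.add_lt_add (not_le.1 h) h'
      rw [ENNReal.add_halves, hadd] at this
      exact this.false

lemma NonAtomic.exists_subset_measure_le (hna : NonAtomic μ) [IsFiniteMeasure μ] {A : Set R}
    (hA : MeasurableSet A) (hA0 : 0 < μ A) {ε : ℝ≥0∞} (hε : 0 < ε) :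
    ∃ D ⊆ A, MeasurableSet D ∧ 0 < μ D ∧ μ D ≤ ε := by
  have key : ∀ n : ℕ, ∃ D ⊆ A, MeasurableSet D ∧ 0 < μ D ∧ μ D ≤ μ A * (2⁻¹) ^ n := by
    intro n
    induction n with
    | zero => exact ⟨A, subset_rfl, hA, hA0, by simp⟩
    | succ n ih =>
      obtain ⟨D, hDA, hD, hD0, hDle⟩ := ih
      obtain ⟨D', hD'D, hD', hD'0, hD'le⟩ := hna.exists_subset_measure_le_half hD hD0
      refine ⟨D', hD'D.trans hDA, hD', hD'0, hD'le.trans ?_⟩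
      rw [pow_succ, ← mul_assoc, ENNReal.div_eq_inv_mul, mul_comm]
      gcongr
  have hlim : Tendsto (fun n : ℕ => μ A * (2⁻¹ : ℝ≥0∞) ^ n) atTop (nhds (μ A * 0)) :=
    ENNReal.Tendsto.const_mul
      (ENNReal.tendsto_pow_atTop_nhds_zero_of_lt_one (by norm_num)) (Or.inr (measure_ne_top μ A))
  rw [mul_zero] at hlim
  obtain ⟨n, hn⟩ := (hlim.eventually_lt_const hε).exists
  obtain ⟨D, hDA, hD, hD0, hDle⟩ := key n
  exact ⟨D, hDA, hD, hD0, hDle.trans hn.le⟩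

/-- **Sierpiński's theorem**: a finite non-atomic measure takes all intermediate values. -/
lemma NonAtomic.exists_subset_measure_eq (hna : NonAtomic μ) [IsFiniteMeasure μ] {A : Set R}
    (hA : MeasurableSet A) {m : ℝ≥0∞} (hm : m ≤ μ A) :
    ∃ D ⊆ A, MeasurableSet D ∧ μ D = m := by
  have hmtop : m ≠ ⊤ := ne_top_of_le_ne_top (measure_ne_top μ A) hm
  have greedy : ∀ C : Set R, ∃ D : Set R, μ C ≤ m → D ⊆ A \ C ∧ MeasurableSet D ∧
      μ C + μ D ≤ m ∧
      ∀ D' : Set R, D' ⊆ A \ C → MeasurableSet D' → μ C + μ D' ≤ m → μ D' ≤ 2 * μ D := by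
    intro C
    by_cases hC : μ C ≤ m
    swap
    · exact ⟨∅, fun h => absurd h hC⟩
    let T : Set (Set R) := {D | D ⊆ A \ C ∧ MeasurableSet D ∧ μ C + μ D ≤ m}
    let S : ℝ≥0∞ := ⨆ D ∈ T, μ D
    have hST : ∀ D ∈ T, μ D ≤ S := fun D hD => le_iSup₂ (f := fun D (_ : D ∈ T) => μ D) D hD
    have hSfin : S ≠ ⊤ := ne_top_of_le_ne_top (measure_ne_top μ univ)
      (iSup₂_le fun D _ => measure_mono (subset_univ D))
    have : ∃ D ∈ T, S ≤ 2 * μ D := by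
      by_cases hS0 : S = 0
      · exact ⟨∅, ⟨empty_subset _, MeasurableSet.empty, by simpa using hC⟩, by simp [hS0]⟩
      · have hlt : S / 2 < S := ENNReal.half_lt_self hS0 hSfin
        obtain ⟨D, hD⟩ := lt_iSup_iff.1 hlt
        obtain ⟨hDT, hD⟩ := lt_iSup_iff.1 hD
        refine ⟨D, hDT, ?_⟩
        rw [mul_comm]
        exact (ENNReal.div_le_iff (by simp) (by simp)).1 hD.le
    obtain ⟨D, hDT, hD⟩ := this
    exact ⟨D, fun _ => ⟨hDT.1, hDT.2.1, hDT.2.2, fun D' h1 h2 h3 =>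
      (hST D' ⟨h1, h2, h3⟩).trans hD⟩⟩
  choose G hG using greedy
  let C : ℕ → Set R := fun n => Nat.rec ∅ (fun _ X => X ∪ G X) n
  have hCs : ∀ n, C (n + 1) = C n ∪ G (C n) := fun _ => rfl
  have hC : ∀ n, MeasurableSet (C n) ∧ C n ⊆ A ∧ μ (C n) ≤ m := by
    intro n
    induction n with
    | zero => exact ⟨MeasurableSet.empty, empty_subset _, by simp [C]⟩
    | succ n ih =>
      obtain ⟨h1, h2, h3, -⟩ := hG _ ih.2.2
      rw [hCs]
      exact ⟨ih.1.union h2, union_subset ih.2.1 (h1.trans sdiff_subset),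
        (measure_union_le _ _).trans h3⟩
  have hCmono : Monotone C := monotone_nat_of_le_succ fun n => by
    rw [hCs]
    exact subset_union_left
  have hUm : MeasurableSet (⋃ n, C n) := MeasurableSet.iUnion fun n => (hC n).1
  have hUle : μ (⋃ n, C n) ≤ m := by
    rw [hCmono.measure_iUnion]
    exact iSup_le fun n => (hC n).2.2
  refine ⟨⋃ n, C n, iUnion_subset fun n => (hC n).2.1, hUm, ?_⟩
  by_contra hne
  have hlt : μ (⋃ n, C n) < m := lt_of_le_of_ne hUle hne
  have hpos : 0 < μ (A \ ⋃ n, C n) := by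
    rw [measure_sdiff (iUnion_subset fun n => (hC n).2.1) hUm.nullMeasurableSet (measure_ne_top _ _)]
    exact tsub_pos_of_lt (hlt.trans_le hm)
  obtain ⟨D, hDA, hD, hD0, hDle⟩ :=
    hna.exists_subset_measure_le (hA.diff hUm) hpos (tsub_pos_of_lt hlt)
  have hDn : ∀ n, μ D ≤ 2 * μ (G (C n)) := by
    intro n
    refine (hG _ (hC n).2.2).2.2.2 D
      (hDA.trans (sdiff_subset_sdiff_right (subset_iUnion C n))) hD ?_
    calc μ (C n) + μ D ≤ μ (⋃ n, C n) + (m - μ (⋃ n, C n)) :=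
          add_le_add (measure_mono (subset_iUnion C n)) hDle
      _ = m := add_tsub_cancel_of_le hUle
  have hgrow : ∀ n : ℕ, n * μ D ≤ 2 * μ (C n) := by
    intro n
    induction n with
    | zero => simp
    | succ n ih =>
      have hdisj : Disjoint (C n) (G (C n)) :=
        (disjoint_sdiff_right).mono_right (hG _ (hC n).2.2).1
      rw [hCs, measure_union hdisj (hG _ (hC n).2.2).2.1, mul_add]
      push_cast
      rw [add_mul, one_mul]
      exact add_le_add ih (hDn n)
  obtain ⟨n, hn⟩ := ENNReal.exists_nat_mul_gt hD0.ne' (b := 2 * m) (by finiteness)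
  exact absurd (hn.trans_le ((hgrow n).trans (mul_le_mul_right (hC n).2.2 2))) (lt_irrefl _)

/-- In a finite non-atomic measure space every decreasing sequence of admissible measures is
realised by a decreasing sequence of sets. -/
lemma NonAtomic.exists_antitone_measure_eq (hna : NonAtomic μ) [IsFiniteMeasure μ]
    {M : ℕ → ℝ≥0∞} (hM : Antitone M) (hM0 : M 0 ≤ μ univ) :
    ∃ F : ℕ → Set R, Antitone F ∧ ∀ j, MeasurableSet (F j) ∧ μ (F j) = M j := by
  have sub : ∀ (A : Set R) (m : ℝ≥0∞), ∃ D : Set R, MeasurableSet A → m ≤ μ A →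
      D ⊆ A ∧ MeasurableSet D ∧ μ D = m := by
    intro A m
    by_cases h : MeasurableSet A ∧ m ≤ μ A
    · obtain ⟨D, h1, h2⟩ := hna.exists_subset_measure_eq h.1 h.2
      exact ⟨D, fun _ _ => ⟨h1, h2⟩⟩
    · exact ⟨∅, fun h1 h2 => absurd ⟨h1, h2⟩ h⟩
  choose G hG using sub
  let F : ℕ → Set R := fun n => Nat.rec (G univ (M 0)) (fun n X => G X (M (n + 1))) n
  have hFs : ∀ n, F (n + 1) = G (F n) (M (n + 1)) := fun _ => rfl
  have hF : ∀ j, MeasurableSet (F j) ∧ μ (F j) = M j := by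
    intro j
    induction j with
    | zero => exact (hG univ (M 0) MeasurableSet.univ hM0).2
    | succ j ih => exact (hG (F j) (M (j + 1)) ih.1 (ih.2 ▸ hM j.le_succ)).2
  refine ⟨F, antitone_nat_of_succ_le fun j => ?_, hF⟩
  exact (hG (F j) (M (j + 1)) (hF j).1 ((hF j).2 ▸ hM j.le_succ)).1

end NonAtomic

section Rearrangement

variable {μ : Measure R} {f : R → ℝ}

lemma distFn_antitone : Antitone (distFn μ f) := fun _ _ h =>
  measure_mono fun _ hx => h.trans_lt hx

lemma rearr_le_of_distFn_le {lam t : ℝ≥0∞} (h : distFn μ f lam ≤ t) : rearr μ f t ≤ lam :=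
  sInf_le h

lemma le_rearr_of_lt_distFn {lam t : ℝ≥0∞} (h : t < distFn μ f lam) : lam ≤ rearr μ f t := by
  refine le_sInf fun l hl => ?_
  by_contra! hlt
  exact absurd (h.trans_le (distFn_antitone hlt.le)) (not_lt.2 hl)

lemma ofReal_abs_const_mul {c : ℝ} (hc : 0 ≤ c) (y : ℝ) :
    ENNReal.ofReal |c * y| = ENNReal.ofReal c * ENNReal.ofReal |y| := by
  rw [abs_mul, abs_of_nonneg hc, ENNReal.ofReal_mul hc]

lemma rearr_const_mul_le {c : ℝ} (hc : 0 < c) (t : ℝ≥0∞) :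
    rearr μ (fun x => c * f x) t ≤ ENNReal.ofReal c * rearr μ f t := by
  have hc0 : ENNReal.ofReal c ≠ 0 := by simpa using hc
  rw [mul_comm, ← ENNReal.div_le_iff_le_mul (Or.inl hc0) (Or.inl ENNReal.ofReal_ne_top)]
  refine le_sInf fun l hl => ?_
  rw [ENNReal.div_le_iff_le_mul (Or.inl hc0) (Or.inl ENNReal.ofReal_ne_top)]
  refine sInf_le (le_trans (measure_mono fun x hx => ?_) hl)
  simp only [mem_ofPred_eq, ofReal_abs_const_mul hc.le] at hx ⊢
  rw [mul_comm l] at hx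
  exact lt_of_mul_lt_mul_left' hx

lemma lorentzNorm_le_of_rearr_le {p q c : ℝ≥0∞} {g : R → ℝ} (hq0 : q ≠ 0) (hc : c ≠ ⊤)
    (h : ∀ t, rearr μ f t ≤ c * rearr μ g t) :
    lorentzNorm μ p q f ≤ c * lorentzNorm μ p q g := by
  unfold lorentzNorm
  split_ifs with hq
  · rw [ENNReal.mul_iSup]
    refine iSup_mono fun t => ?_
    rw [mul_left_comm]
    gcongr
    exact h _
  · have hq' : 0 < q.toReal := ENNReal.toReal_pos hq0 hq
    have hcq : c = (c ^ q.toReal) ^ (q⁻¹).toReal := by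
      rw [ENNReal.toReal_inv, ← ENNReal.rpow_mul, mul_inv_cancel₀ hq'.ne', ENNReal.rpow_one]
    nth_rewrite 1 [hcq]
    rw [← ENNReal.mul_rpow_of_nonneg _ _ ENNReal.toReal_nonneg,
      ← lintegral_const_mul' _ _ (ENNReal.rpow_ne_top_of_nonneg hq'.le hc)]
    gcongr with t
    rw [← mul_div_assoc, ← ENNReal.mul_rpow_of_nonneg _ _ hq'.le, mul_left_comm]
    gcongr
    exact h _

lemma lorentzNorm_const_mul_le {p q : ℝ≥0∞} (hq0 : q ≠ 0) {c : ℝ} (hc : 0 < c) :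
    lorentzNorm μ p q (fun x => c * f x) ≤ ENNReal.ofReal c * lorentzNorm μ p q f :=
  lorentzNorm_le_of_rearr_le hq0 ENNReal.ofReal_ne_top (rearr_const_mul_le hc)

end Rearrangement

section Geometric

lemma sum_range_succ_le_two_mul {h : ℕ → ℝ≥0∞} (hh : ∀ j, 2 * h j ≤ h (j + 1)) (n : ℕ) :
    ∑ j ∈ Finset.range (n + 1), h j ≤ 2 * h n := by
  induction n with
  | zero => simp [two_mul]
  | succ n ih =>
    rw [Finset.sum_range_succ, two_mul (h (n + 1))]
    gcongr
    exact ih.trans (hh n)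

/-- A sequence which at least doubles in each step has its partial sums controlled by its
largest term. -/
lemma tsum_ite_le_two_mul {h : ℕ → ℝ≥0∞} (hh : ∀ j, 2 * h j ≤ h (j + 1)) (P : ℕ → Prop)
    [DecidablePred P] {Y : ℝ≥0∞} (hP : ∀ j, P j → h j ≤ Y) :
    ∑' j, (if P j then h j else 0) ≤ 2 * Y := by
  refine ENNReal.tsum_le_of_sum_range_le fun n => ?_
  rw [← Finset.sum_filter]
  obtain hemp | hne := ((Finset.range n).filter P).eq_empty_or_nonempty
  · simp [hemp]
  · set k := ((Finset.range n).filter P).max' hne with hk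
    have hkP : P k := (Finset.mem_filter.1 (Finset.max'_mem _ hne)).2
    calc ∑ j ∈ (Finset.range n).filter P, h j ≤ ∑ j ∈ Finset.range (k + 1), h j :=
          Finset.sum_le_sum_of_subset fun j hj =>
            Finset.mem_range.2 (Nat.lt_succ_of_le (Finset.le_max' _ j hj))
      _ ≤ 2 * h k := sum_range_succ_le_two_mul hh k
      _ ≤ 2 * Y := by gcongr; exact hP k hkP

lemma two_mul_two_pow_rpow_le {σ : ℝ} (hσ : 1 ≤ σ) (j : ℕ) :
    2 * ((2 : ℝ≥0∞) ^ j) ^ σ ≤ ((2 : ℝ≥0∞) ^ (j + 1)) ^ σ := by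
  rw [pow_succ', ENNReal.mul_rpow_of_nonneg _ _ (by linarith)]
  gcongr
  simpa using ENNReal.rpow_le_rpow_of_exponent_le (x := 2) (by norm_num) hσ

end Geometric

section Weight

lemma lintegral_rpow_weight {α : ℝ} (hα : 0 < α) {m : ℝ≥0∞} (hm : m ≠ ⊤) :
    ∫⁻ t in Ioi (0 : ℝ),
      (if ENNReal.ofReal t < m then ENNReal.ofReal t ^ α / ENNReal.ofReal t else 0) =
      m ^ α / ENNReal.ofReal α := by
  lift m to NNReal using hm
  have h1 : ∫⁻ t in Ioi (0 : ℝ),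
      (if ENNReal.ofReal t < m then ENNReal.ofReal t ^ α / ENNReal.ofReal t else 0) =
      ∫⁻ t in Ioc (0 : ℝ) m, ENNReal.ofReal (t ^ (α - 1)) := by
    rw [← setLIntegral_congr Ioo_ae_eq_Ioc, ← lintegral_indicator measurableSet_Ioi,
      ← lintegral_indicator measurableSet_Ioo]
    congr 1
    ext t
    by_cases ht : 0 < t
    · have : ENNReal.ofReal t < m ↔ t < m := by
        rw [← ENNReal.ofReal_coe_nnreal, ENNReal.ofReal_lt_ofReal_iff_of_nonneg ht.le]
      by_cases htm : t < m
      · simp only [indicator, mem_Ioi, ht, mem_Ioo, htm, this, if_true, and_self]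
        rw [ENNReal.ofReal_rpow_of_pos ht, ← ENNReal.ofReal_div_of_pos ht, Real.rpow_sub_one ht.ne']
      · simp [indicator, ht, htm, this]
    · simp [indicator, ht]
  rw [h1, ← ofReal_integral_eq_lintegral_ofReal, ← intervalIntegral.integral_of_le m.coe_nonneg,
    integral_rpow (Or.inl (by linarith)), sub_add_cancel, Real.zero_rpow hα.ne', sub_zero,
    ENNReal.ofReal_div_of_pos hα, ← ENNReal.ofReal_rpow_of_nonneg m.coe_nonneg hα.le]
  · simp
  · exact (intervalIntegrable_iff_integrableOn_Ioc_of_le m.coe_nonneg).1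
      (intervalIntegral.intervalIntegrable_rpow' (by linarith))
  · refine (ae_restrict_iff' measurableSet_Ioc).2 (Eventually.of_forall fun t ht => ?_)
    exact Real.rpow_nonneg ht.1.le _

lemma measurable_rpow_weight (α : ℝ) (m : ℝ≥0∞) : Measurable fun t : ℝ =>
    if ENNReal.ofReal t < m then ENNReal.ofReal t ^ α / ENNReal.ofReal t else 0 :=
  Measurable.ite (measurableSet_lt ENNReal.measurable_ofReal measurable_const)
    (by fun_prop) measurable_const

end Weight

section Discretization

variable {μ : Measure R}

/-- The `ℓ^p` size of a non-negative sequence. -/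
def ellSize (p : ℝ≥0∞) (a : ℕ → ℝ≥0∞) : ℝ≥0∞ :=
  if p = ⊤ then ⨆ j, a j else (∑' j, a j ^ p.toReal) ^ (p.toReal)⁻¹

/-- The sequence `2^{jr} μ(|f| > 2^j)`, `j ≥ 0`. -/
def levelSeq (μ : Measure R) (r : ℝ) (f : R → ℝ) (j : ℕ) : ℝ≥0∞ :=
  ((2 : ℝ≥0∞) ^ j) ^ r * distFn μ f (2 ^ j)

lemma lorentzNorm_top_eq {r : ℝ} (hr : 0 < r) (f : R → ℝ) :
    lorentzNorm μ (ENNReal.ofReal r) ⊤ f =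
      ⨆ t : Ioi (0 : ℝ), ENNReal.ofReal t.1 ^ r⁻¹ * rearr μ f (ENNReal.ofReal t.1) := by
  simp only [lorentzNorm, if_true, ENNReal.toReal_inv, ENNReal.toReal_ofReal hr.le]

lemma lorentzNorm_rpow_eq {r : ℝ} (hr : 0 < r) {s : ℝ≥0∞} (hs0 : s ≠ 0) (hs : s ≠ ⊤)
    (f : R → ℝ) :
    lorentzNorm μ (ENNReal.ofReal r) s f ^ s.toReal =
      ∫⁻ t in Ioi (0 : ℝ), ENNReal.ofReal t ^ (s.toReal / r) / ENNReal.ofReal t *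
        rearr μ f (ENNReal.ofReal t) ^ s.toReal := by
  have hσ : 0 < s.toReal := ENNReal.toReal_pos hs0 hs
  simp only [lorentzNorm, if_neg hs, ENNReal.toReal_inv, ENNReal.toReal_ofReal hr.le]
  rw [← ENNReal.rpow_mul, inv_mul_cancel₀ hσ.ne', ENNReal.rpow_one]
  congr 1
  ext t
  rw [ENNReal.mul_rpow_of_nonneg _ _ hσ.le, ← ENNReal.rpow_mul, inv_mul_eq_div,
    ENNReal.mul_div_right_comm]

lemma rpow_eq_rpow_rpow_inv_div {r σ : ℝ} (hσ : 0 < σ) (x : ℝ≥0∞) :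
    x ^ r = (x ^ σ) ^ (σ / r)⁻¹ := by
  rw [← ENNReal.rpow_mul, inv_div, mul_div_cancel₀ _ hσ.ne']

lemma ellSize_levelSeq_le [IsFiniteMeasure μ] {r : ℝ} {s : ℝ≥0∞} (hr : 1 < r)
    (hrs : ENNReal.ofReal r < s) :
    ∃ C : ℝ≥0∞, C ≠ ⊤ ∧ ∀ f : R → ℝ, ellSize (s / ENNReal.ofReal r) (levelSeq μ r f) ≤
      C * lorentzNorm μ (ENNReal.ofReal r) s f ^ r := by
  have hr0 : 0 < r := by linarith
  have hpow : ∀ j : ℕ, ((2 : ℝ≥0∞) ^ j) ^ r ≠ 0 ∧ ((2 : ℝ≥0∞) ^ j) ^ r ≠ ⊤ := fun j =>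
    ⟨by simp [ENNReal.rpow_eq_zero_iff], ENNReal.rpow_ne_top_of_nonneg hr0.le (by finiteness)⟩
  by_cases hs : s = ⊤
  · subst hs
    refine ⟨1, ENNReal.one_ne_top, fun f => ?_⟩
    have : (⊤ : ℝ≥0∞) / ENNReal.ofReal r = ⊤ := ENNReal.top_div_of_ne_top ENNReal.ofReal_ne_top
    rw [this, ellSize, if_pos rfl, one_mul]
    refine iSup_le fun j => ?_
    rw [levelSeq, mul_comm, ← ENNReal.le_div_iff_mul_le (Or.inl (hpow j).1) (Or.inl (hpow j).2)]
    refine le_of_forall_lt_imp_le_of_dense fun c hc => ?_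
    rcases eq_or_ne c 0 with rfl | hc0
    · exact zero_le
    have hcr : ENNReal.ofReal c.toReal = c := ENNReal.ofReal_toReal hc.ne_top
    have hcpos : 0 < c.toReal := ENNReal.toReal_pos hc0 hc.ne_top
    rw [ENNReal.le_div_iff_mul_le (Or.inl (hpow j).1) (Or.inl (hpow j).2)]
    have h1 : c ^ r⁻¹ * 2 ^ j ≤ lorentzNorm μ (ENNReal.ofReal r) ⊤ f := by
      rw [lorentzNorm_top_eq hr0]
      refine le_trans ?_ (le_iSup _ (⟨c.toReal, hcpos⟩ : Ioi (0 : ℝ)))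
      simp only [hcr]
      gcongr
      exact le_rearr_of_lt_distFn hc
    calc c * (2 ^ j) ^ r = (c ^ r⁻¹ * 2 ^ j) ^ r := by
          rw [ENNReal.mul_rpow_of_nonneg _ _ hr0.le, ← ENNReal.rpow_mul,
            inv_mul_cancel₀ hr0.ne', ENNReal.rpow_one]
      _ ≤ _ := by gcongr
  · have hs0 : s ≠ 0 := (zero_le.trans_lt hrs).ne'
    have hrσ : r < s.toReal := (ENNReal.ofReal_lt_iff_lt_toReal hr0.le hs).1 hrs
    set σ := s.toReal with hσdef
    have hσ : 0 < σ := by linarith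
    have hα : 0 < σ / r := by positivity
    have hα' : ENNReal.ofReal (σ / r) ≠ 0 := by simpa using hα
    have hp : s / ENNReal.ofReal r ≠ ⊤ := ENNReal.div_ne_top hs (by simpa using hr0)
    have hpt : (s / ENNReal.ofReal r).toReal = σ / r := by
      rw [ENNReal.toReal_div, ENNReal.toReal_ofReal hr0.le]
    refine ⟨(2 * ENNReal.ofReal (σ / r)) ^ (σ / r)⁻¹,
      ENNReal.rpow_ne_top_of_nonneg (by positivity) (by finiteness), fun f => ?_⟩
    rw [ellSize, if_neg hp, hpt, rpow_eq_rpow_rpow_inv_div hσ (lorentzNorm _ _ _ _),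
      ← ENNReal.mul_rpow_of_nonneg _ _ (by positivity)]
    refine ENNReal.rpow_le_rpow ?_ (by positivity)
    rw [hσdef, lorentzNorm_rpow_eq hr0 hs0 hs, ← hσdef, mul_right_comm,
      ← ENNReal.div_le_iff_le_mul (Or.inl hα') (Or.inl ENNReal.ofReal_ne_top)]
    have hterm : ∀ j, levelSeq μ r f j ^ (σ / r) / ENNReal.ofReal (σ / r) =
        ∫⁻ t in Ioi (0 : ℝ), ((2 : ℝ≥0∞) ^ j) ^ σ *
          (if ENNReal.ofReal t < distFn μ f (2 ^ j) then
            ENNReal.ofReal t ^ (σ / r) / ENNReal.ofReal t else 0) := by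
      intro j
      rw [lintegral_const_mul _ (measurable_rpow_weight _ _),
        lintegral_rpow_weight hα (m := distFn μ f (2 ^ j)) (measure_ne_top μ _), levelSeq,
        ENNReal.mul_rpow_of_nonneg _ _ hα.le, ← ENNReal.rpow_mul, mul_div_cancel₀ _ hr0.ne',
        mul_div_assoc]
    calc (∑' j, levelSeq μ r f j ^ (σ / r)) / ENNReal.ofReal (σ / r)
        = ∑' j, levelSeq μ r f j ^ (σ / r) / ENNReal.ofReal (σ / r) := by
          simp only [div_eq_mul_inv, ENNReal.tsum_mul_right]
      _ = ∫⁻ t in Ioi (0 : ℝ), ∑' j, ((2 : ℝ≥0∞) ^ j) ^ σ *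
          (if ENNReal.ofReal t < distFn μ f (2 ^ j) then
            ENNReal.ofReal t ^ (σ / r) / ENNReal.ofReal t else 0) := by
          rw [lintegral_tsum fun j => ((measurable_rpow_weight _ _).const_mul _).aemeasurable]
          exact tsum_congr hterm
      _ ≤ ∫⁻ t in Ioi (0 : ℝ), 2 * (ENNReal.ofReal t ^ (σ / r) / ENNReal.ofReal t *
            rearr μ f (ENNReal.ofReal t) ^ σ) := by
          refine lintegral_mono fun t => ?_
          have : ∀ j : ℕ, ((2 : ℝ≥0∞) ^ j) ^ σ * (if ENNReal.ofReal t < distFn μ f (2 ^ j) then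
              ENNReal.ofReal t ^ (σ / r) / ENNReal.ofReal t else 0) =
              ENNReal.ofReal t ^ (σ / r) / ENNReal.ofReal t *
              (if ENNReal.ofReal t < distFn μ f (2 ^ j) then ((2 : ℝ≥0∞) ^ j) ^ σ else 0) := by
            intro j
            split_ifs <;> simp [mul_comm]
          simp only [this]
          rw [ENNReal.tsum_mul_left, mul_left_comm]
          gcongr
          exact tsum_ite_le_two_mul (two_mul_two_pow_rpow_le (by linarith)) _ fun j hj =>
            ENNReal.rpow_le_rpow (le_rearr_of_lt_distFn hj) hσ.le
      _ = _ := lintegral_const_mul' _ _ (by simp)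

end Discretization

section Construction

variable {μ : Measure R}

/-- The function `∑_{j < N} 2^j χ_{F_j}`. -/
def dyadicSum {X : Type*} (F : ℕ → Set X) (N : ℕ) (x : X) : ℝ :=
  ∑ j ∈ Finset.range N, (F j).indicator (fun _ => (2 : ℝ) ^ j) x

lemma dyadicSum_nonneg {X : Type*} (F : ℕ → Set X) (N : ℕ) (x : X) : 0 ≤ dyadicSum F N x :=
  Finset.sum_nonneg fun _ _ => indicator_nonneg (fun _ _ => by positivity) _

lemma measurable_dyadicSum {F : ℕ → Set R} (hF : ∀ j, MeasurableSet (F j)) (N : ℕ) :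
    Measurable (dyadicSum F N) :=
  Finset.measurable_fun_sum _ fun j _ => measurable_const.indicator (hF j)

lemma two_pow_le_dyadicSum {X : Type*} {F : ℕ → Set X} {N j : ℕ} (hj : j < N) {x : X}
    (hx : x ∈ F j) :
    (2 : ℝ) ^ j ≤ dyadicSum F N x := by
  have := Finset.single_le_sum (f := fun j => (F j).indicator (fun _ => (2 : ℝ) ^ j) x)
    (fun _ _ => indicator_nonneg (fun _ _ => by positivity) _) (Finset.mem_range.2 hj)
  simpa [dyadicSum, hx] using this

lemma dyadicSum_lt_two_pow {X : Type*} {F : ℕ → Set X} (hF : Antitone F) (N : ℕ) {k : ℕ} {x : X}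
    (hx : x ∉ F k) : dyadicSum F N x < 2 ^ k := by
  have h1 : dyadicSum F N x ≤ ∑ j ∈ Finset.range k, (2 : ℝ) ^ j := by
    classical
    unfold dyadicSum
    simp only [indicator_apply]
    rw [← Finset.sum_filter]
    refine Finset.sum_le_sum_of_subset_of_nonneg (fun j hj => ?_) fun _ _ _ => by positivity
    rw [Finset.mem_range]
    by_contra! hkj
    exact hx (hF hkj (Finset.mem_filter.1 hj).2)
  have h2 : ∑ j ∈ Finset.range k, (2 : ℝ) ^ j = 2 ^ k - 1 := by
    rw [geom_sum_eq (by norm_num)]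
    norm_num
  linarith

lemma dyadicSum_eq_zero {X : Type*} {F : ℕ → Set X} (hF : Antitone F) (N : ℕ) {x : X}
    (hx : x ∉ F 0) :
    dyadicSum F N x = 0 :=
  Finset.sum_eq_zero fun j _ => indicator_of_notMem (fun h => hx (hF (Nat.zero_le j) h)) _

lemma rearr_dyadicSum {F : ℕ → Set R} (hF : Antitone F) {N : ℕ} {m : ℕ → ℝ≥0∞}
    (hm : ∀ j, N ≤ j → m j = 0) (hFm : ∀ j, μ (F j) = ⨆ i, ⨆ (_ : j ≤ i), m i) (t : ℝ≥0∞) :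
    rearr μ (dyadicSum F N) t = 0 ∨
      ∃ i, t < m i ∧ rearr μ (dyadicSum F N) t ≤ 2 ^ (i + 1) := by
  classical
  have hex : ∃ k, μ (F k) ≤ t := by
    refine ⟨N, ?_⟩
    rw [hFm]
    exact iSup₂_le fun i hi => by simp [hm i hi]
  have hk := Nat.find_spec hex
  have hmin : ∀ j < Nat.find hex, t < μ (F j) := fun j hj => not_le.1 (Nat.find_min hex hj)
  rcases hkk : Nat.find hex with _ | k
  · left
    rw [hkk] at hk
    refine le_antisymm (rearr_le_of_distFn_le (le_trans (measure_mono fun x hx => ?_) hk)) zero_le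
    by_contra hxF
    simp [dyadicSum_eq_zero hF N hxF] at hx
  · right
    rw [hkk] at hk
    have hlt := hmin k (by omega)
    rw [hFm] at hlt
    obtain ⟨i, hi⟩ := lt_iSup_iff.1 hlt
    obtain ⟨hki, hi⟩ := lt_iSup_iff.1 hi
    refine ⟨i, hi, le_trans (b := (2 : ℝ≥0∞) ^ (k + 1)) ?_ (by gcongr; norm_num)⟩
    refine rearr_le_of_distFn_le (le_trans (measure_mono fun x hx => ?_) hk)
    by_contra hxF
    have h1 := dyadicSum_lt_two_pow hF N hxF
    simp only [mem_ofPred_eq, abs_of_nonneg (dyadicSum_nonneg F N x)] at hx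
    have h2 : ENNReal.ofReal (2 ^ (k + 1)) = (2 : ℝ≥0∞) ^ (k + 1) := by
      rw [ENNReal.ofReal_pow (by norm_num)]
      norm_num
    rw [← h2] at hx
    exact absurd (ENNReal.ofReal_le_ofReal h1.le) (not_le.2 hx)

lemma lorentzNorm_dyadicSum_le [IsFiniteMeasure μ] {r : ℝ} {s : ℝ≥0∞} (hr : 1 < r)
    (hrs : ENNReal.ofReal r < s) :
    ∃ C : ℝ≥0∞, C ≠ ⊤ ∧ ∀ (F : ℕ → Set R) (N : ℕ) (m : ℕ → ℝ≥0∞), Antitone F →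
      (∀ j, N ≤ j → m j = 0) → (∀ j, m j ≠ ⊤) → (∀ j, μ (F j) = ⨆ i, ⨆ (_ : j ≤ i), m i) →
      lorentzNorm μ (ENNReal.ofReal r) s (dyadicSum F N) ^ r ≤
        C * ellSize (s / ENNReal.ofReal r) (fun j => ((2 : ℝ≥0∞) ^ j) ^ r * m j) := by
  have hr0 : 0 < r := by linarith
  by_cases hs : s = ⊤
  · subst hs
    refine ⟨2 ^ r, ENNReal.rpow_ne_top_of_nonneg hr0.le (by simp), fun F N m hF hm hmt hFm => ?_⟩
    have : (⊤ : ℝ≥0∞) / ENNReal.ofReal r = ⊤ := ENNReal.top_div_of_ne_top ENNReal.ofReal_ne_top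
    rw [this, ellSize, if_pos rfl, ← ENNReal.le_rpow_inv_iff hr0, lorentzNorm_top_eq hr0]
    refine iSup_le fun t => ?_
    obtain h | ⟨i, hti, hi⟩ := rearr_dyadicSum hF hm hFm (ENNReal.ofReal t.1)
    · simp [h]
    · rw [ENNReal.le_rpow_inv_iff hr0]
      calc (ENNReal.ofReal t.1 ^ r⁻¹ * rearr μ (dyadicSum F N) (ENNReal.ofReal t.1)) ^ r
          ≤ (m i ^ r⁻¹ * 2 ^ (i + 1)) ^ r := by gcongr
        _ = 2 ^ r * ((2 ^ i) ^ r * m i) := by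
          rw [pow_succ', ENNReal.mul_rpow_of_nonneg _ _ hr0.le,
            ENNReal.mul_rpow_of_nonneg _ _ hr0.le, ← ENNReal.rpow_mul, inv_mul_cancel₀ hr0.ne',
            ENNReal.rpow_one]
          ring
        _ ≤ _ := by
          gcongr
          exact le_iSup (fun j => ((2 : ℝ≥0∞) ^ j) ^ r * m j) i
  · have hs0 : s ≠ 0 := (zero_le.trans_lt hrs).ne'
    have hrσ : r < s.toReal := (ENNReal.ofReal_lt_iff_lt_toReal hr0.le hs).1 hrs
    set σ := s.toReal with hσdef
    have hσ : 0 < σ := by linarith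
    have hα : 0 < σ / r := by positivity
    have hα' : ENNReal.ofReal (σ / r) ≠ 0 := by simpa using hα
    have hp : s / ENNReal.ofReal r ≠ ⊤ := ENNReal.div_ne_top hs (by simpa using hr0)
    have hpt : (s / ENNReal.ofReal r).toReal = σ / r := by
      rw [ENNReal.toReal_div, ENNReal.toReal_ofReal hr0.le]
    refine ⟨(2 ^ σ / ENNReal.ofReal (σ / r)) ^ (σ / r)⁻¹,
      ENNReal.rpow_ne_top_of_nonneg (by positivity) (ENNReal.div_ne_top
        (ENNReal.rpow_ne_top_of_nonneg hσ.le (by simp)) hα'), fun F N m hF hm hmt hFm => ?_⟩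
    rw [ellSize, if_neg hp, hpt, rpow_eq_rpow_rpow_inv_div hσ (lorentzNorm _ _ _ _),
      ← ENNReal.mul_rpow_of_nonneg _ _ (by positivity)]
    refine ENNReal.rpow_le_rpow ?_ (by positivity)
    rw [hσdef, lorentzNorm_rpow_eq hr0 hs0 hs, ← hσdef]
    calc ∫⁻ t in Ioi (0 : ℝ), ENNReal.ofReal t ^ (σ / r) / ENNReal.ofReal t *
          rearr μ (dyadicSum F N) (ENNReal.ofReal t) ^ σ
        ≤ ∫⁻ t in Ioi (0 : ℝ), ∑' j, ((2 : ℝ≥0∞) ^ (j + 1)) ^ σ *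
          (if ENNReal.ofReal t < m j then
            ENNReal.ofReal t ^ (σ / r) / ENNReal.ofReal t else 0) := by
          refine lintegral_mono fun t => ?_
          obtain h | ⟨i, hti, hi⟩ := rearr_dyadicSum hF hm hFm (ENNReal.ofReal t)
          · simp [h, hσ]
          · refine le_trans ?_ (ENNReal.le_tsum i)
            rw [if_pos hti, mul_comm]
            gcongr
      _ = ∑' j, ((2 : ℝ≥0∞) ^ (j + 1)) ^ σ * (m j ^ (σ / r) / ENNReal.ofReal (σ / r)) := by
          rw [lintegral_tsum fun j => ((measurable_rpow_weight _ _).const_mul _).aemeasurable]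
          refine tsum_congr fun j => ?_
          rw [lintegral_const_mul _ (measurable_rpow_weight _ _),
            lintegral_rpow_weight hα (hmt j)]
      _ = ∑' j, 2 ^ σ / ENNReal.ofReal (σ / r) * (((2 : ℝ≥0∞) ^ j) ^ r * m j) ^ (σ / r) := by
          refine tsum_congr fun j => ?_
          rw [pow_succ', ENNReal.mul_rpow_of_nonneg _ _ hσ.le,
            ENNReal.mul_rpow_of_nonneg _ _ hα.le, ← ENNReal.rpow_mul, mul_div_cancel₀ _ hr0.ne']
          simp only [div_eq_mul_inv]
          ring
      _ = _ := ENNReal.tsum_mul_left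

end Construction

section Duality

variable {p : ℝ≥0∞} {β : ℕ → ℝ≥0∞}

lemma ellSize_pi_single_le (hp : p ≠ 0) (c : ℝ≥0∞) (j : ℕ) :
    ellSize p (Pi.single j c) ≤ c := by
  unfold ellSize
  split_ifs with h
  · refine iSup_le fun i => ?_
    rcases eq_or_ne i j with rfl | hij
    · simp
    · simp [Pi.single_eq_of_ne hij]
  · have hp' : 0 < p.toReal := ENNReal.toReal_pos hp h
    rw [tsum_eq_single j fun i hij => by simp [Pi.single_eq_of_ne hij, hp'], Pi.single_eq_same,
      ← ENNReal.rpow_mul, mul_inv_cancel₀ hp'.ne', ENNReal.rpow_one]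

lemma ellSize_apply_le (hp : p ≠ 0) (a : ℕ → ℝ≥0∞) (j : ℕ) : a j ≤ ellSize p a := by
  unfold ellSize
  split_ifs with h
  · exact le_iSup a j
  · have hp' : 0 < p.toReal := ENNReal.toReal_pos hp h
    rw [ENNReal.le_rpow_inv_iff hp']
    exact ENNReal.le_tsum (f := fun j => a j ^ p.toReal) j

lemma ne_top_of_pairing_bounded (hp : p ≠ 0) {c K : ℝ≥0∞} (hc0 : c ≠ 0) (hK : K ≠ ⊤)
    (hβ : ∀ (N : ℕ) (a : ℕ → ℝ≥0∞), (∀ j, N ≤ j → a j = 0) → ellSize p a ≤ c →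
      ∑' j, β j * a j ≤ K) (j : ℕ) : β j ≠ ⊤ := by
  intro h
  have h1 := hβ (j + 1) (Pi.single j c) (fun i hi => Pi.single_eq_of_ne (by omega) _)
    (ellSize_pi_single_le hp c j)
  have h2 := (ENNReal.le_tsum (f := fun i => β i * Pi.single (M := fun _ => ℝ≥0∞) j c i) j).trans h1
  rw [Pi.single_eq_same, h, ENNReal.top_mul hc0, top_le_iff] at h2
  exact hK h2

/-- A sequence acting boundedly on `ℓ^p`, `p > 1`, has tails acting with arbitrarily small norm. -/
lemma exists_tail_pairing_le (hp : 1 < p) {c K : ℝ≥0∞} (hc0 : c ≠ 0) (hc : c ≠ ⊤) (hK : K ≠ ⊤)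
    (hβ : ∀ (N : ℕ) (a : ℕ → ℝ≥0∞), (∀ j, N ≤ j → a j = 0) → ellSize p a ≤ c →
      ∑' j, β j * a j ≤ K) {L ε : ℝ≥0∞} (hL : L ≠ ⊤) (hε : 0 < ε) :
    ∃ J, ∀ a : ℕ → ℝ≥0∞, ellSize p a ≤ L → ∑' j, β (j + J) * a (j + J) ≤ ε := by
  have hβt : ∀ j, β j ≠ ⊤ := ne_top_of_pairing_bounded (zero_lt_one.trans hp).ne' hc0 hK hβ
  by_cases h : p = ⊤
  · have hsum : ∑' j, β j ≠ ⊤ := by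
      refine ne_top_of_le_ne_top (b := K / c) (ENNReal.div_ne_top hK hc0) ?_
      refine ENNReal.tsum_le_of_sum_range_le fun N => ?_
      rw [ENNReal.le_div_iff_mul_le (Or.inl hc0) (Or.inl hc), Finset.sum_mul]
      refine le_trans ?_ (hβ N (fun j => if j < N then c else 0) (fun j hj => by simp [hj]) ?_)
      · refine le_trans (Finset.sum_le_sum fun j hj => ?_) (ENNReal.sum_le_tsum (Finset.range N))
        simp [Finset.mem_range.1 hj]
      · rw [ellSize, if_pos h]
        exact iSup_le fun j => by split_ifs <;> simp
    have hlim := ENNReal.Tendsto.mul_const (b := L) (ENNReal.tendsto_sum_nat_add β hsum) (Or.inr hL)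
    rw [zero_mul] at hlim
    obtain ⟨J, hJ⟩ := (hlim.eventually_lt_const hε).exists
    refine ⟨J, fun a ha => le_trans ?_ hJ.le⟩
    rw [← ENNReal.tsum_mul_right]
    gcongr with j
    exact (ellSize_apply_le (zero_lt_one.trans hp).ne' a _).trans ha
  · have hp1 : 1 < p.toReal := by
      simpa using (ENNReal.toReal_lt_toReal ENNReal.one_ne_top h).2 hp
    set ρ := p.toReal with hρ
    have hpq : ρ.HolderConjugate (Real.conjExponent ρ) := Real.HolderConjugate.conjExponent hp1
    set q := Real.conjExponent ρ
    lift β to ℕ → NNReal using hβt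
    have hsum : ∑' j, (β j : ℝ≥0∞) ^ q ≠ ⊤ := by
      refine ne_top_of_le_ne_top (b := (K / c) ^ q)
        (ENNReal.rpow_ne_top_of_nonneg hpq.symm.nonneg (ENNReal.div_ne_top hK hc0)) ?_
      refine ENNReal.tsum_le_of_sum_range_le fun N => ?_
      obtain ⟨g, hg1, hg2⟩ := (NNReal.isGreatest_Lp (s := Finset.range N) β hpq.symm).1
      rw [mem_ofPred_eq] at hg1
      simp only at hg2
      rw [← ENNReal.rpow_inv_le_iff hpq.symm.pos,
        ENNReal.le_div_iff_mul_le (Or.inl hc0) (Or.inl hc)]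
      have hg3 : (∑ j ∈ Finset.range N, (β j : ℝ≥0∞) ^ q) ^ q⁻¹ =
          ∑ j ∈ Finset.range N, (β j : ℝ≥0∞) * g j := by
        have := congrArg (fun x : NNReal => (x : ℝ≥0∞)) hg2
        simp only [one_div] at this
        rw [ENNReal.coe_rpow_of_nonneg _ (by simpa using hpq.symm.nonneg)] at this
        push_cast at this
        rw [this]
        congr 1
        refine Finset.sum_congr rfl fun j _ => ?_
        rw [ENNReal.coe_rpow_of_nonneg _ hpq.symm.nonneg]
      rw [hg3, Finset.sum_mul]
      refine le_trans ?_ (hβ N (fun j => if j < N then g j * c else 0) (fun j hj => by simp [hj]) ?_)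
      · refine le_trans (Finset.sum_le_sum fun j hj => ?_) (ENNReal.sum_le_tsum (Finset.range N))
        simp [Finset.mem_range.1 hj, mul_assoc]
      · rw [ellSize, if_neg h, ← hρ, ENNReal.rpow_inv_le_iff hpq.pos,
          tsum_eq_sum (s := Finset.range N) fun j hj => by
            simp [Finset.mem_range.not.1 hj, hpq.pos]]
        calc ∑ j ∈ Finset.range N, (if j < N then (g j : ℝ≥0∞) * c else 0) ^ ρ
            = ∑ j ∈ Finset.range N, ((g j ^ ρ : NNReal) : ℝ≥0∞) * c ^ ρ := by
              refine Finset.sum_congr rfl fun j hj => ?_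
              rw [if_pos (Finset.mem_range.1 hj), ENNReal.mul_rpow_of_nonneg _ _ hpq.nonneg,
                ENNReal.coe_rpow_of_nonneg _ hpq.nonneg]
          _ = ((∑ j ∈ Finset.range N, g j ^ ρ : NNReal) : ℝ≥0∞) * c ^ ρ := by
              rw [← Finset.sum_mul]
              push_cast
              rfl
          _ ≤ 1 * c ^ ρ := by
              gcongr
              exact_mod_cast hg1
          _ = c ^ ρ := one_mul _
    have hlim := ENNReal.Tendsto.mul_const (b := L)
      ((ENNReal.continuous_rpow_const (y := q⁻¹)).tendsto 0 |>.comp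
        (ENNReal.tendsto_sum_nat_add (fun j => (β j : ℝ≥0∞) ^ q) hsum)) (Or.inr hL)
    rw [ENNReal.zero_rpow_of_pos (by simpa using hpq.symm.pos), zero_mul] at hlim
    obtain ⟨J, hJ⟩ := (hlim.eventually_lt_const hε).exists
    refine ⟨J, fun a ha => le_trans ?_ hJ.le⟩
    rw [ellSize, if_neg h, ← hρ] at ha
    refine ENNReal.tsum_le_of_sum_range_le fun N => ?_
    refine (ENNReal.inner_le_Lp_mul_Lq _ _ _ hpq.symm).trans ?_
    simp only [one_div]
    refine mul_le_mul' (ENNReal.rpow_le_rpow (ENNReal.sum_le_tsum _) (by simpa using hpq.symm.nonneg))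
      (le_trans (ENNReal.rpow_le_rpow ?_ (by simpa using hpq.nonneg)) ha)
    exact (ENNReal.sum_le_tsum _).trans
      (ENNReal.tsum_comp_le_tsum_of_injective (add_left_injective J) _)

end Duality

section Luxemburg

variable {μ : Measure R}

lemma YoungFunction.two_mul_le (B : YoungFunction) (t : ℝ≥0∞) :
    2 * B.toFun t ≤ B.toFun (2 * t) := by
  have h := B.convex' (2 * t) 0 2⁻¹ (by simp)
  rw [B.map_zero, mul_zero, add_zero, add_zero, ← mul_assoc,
    ENNReal.inv_mul_cancel (by simp) (by simp), one_mul] at h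
  calc 2 * B.toFun t ≤ 2 * (2⁻¹ * B.toFun (2 * t)) := by gcongr
    _ = B.toFun (2 * t) := by
      rw [← mul_assoc, ENNReal.mul_inv_cancel (by simp) (by simp), one_mul]

lemma YoungFunction.exists_pos_mul_le_one (B : YoungFunction) {m : ℝ≥0∞} (hm : m ≠ ⊤) :
    ∃ δ : ℝ≥0∞, 0 < δ ∧ δ ≠ ⊤ ∧ B.toFun δ * m ≤ 1 := by
  have hlim := ENNReal.Tendsto.mul_const (b := m) B.tendsto_zero (Or.inr hm)
  rw [zero_mul] at hlim
  have h1 := hlim.eventually_lt_const zero_lt_one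
  have h2 : ∀ᶠ t : ℝ≥0∞ in nhdsWithin 0 (Ioi 0), t < 1 :=
    mem_nhdsWithin_of_mem_nhds (Iio_mem_nhds zero_lt_one)
  obtain ⟨δ, ⟨hδ1, hδ2⟩, hδ0⟩ := ((h1.and h2).and self_mem_nhdsWithin).exists
  exact ⟨δ, hδ0, (hδ2.trans ENNReal.one_lt_top).ne, hδ1.le⟩

lemma luxNorm_const_mul_le {B : YoungFunction} {f : R → ℝ} {c : ℝ} (hc : 0 < c) :
    luxNorm μ B (fun x => c * f x) ≤ ENNReal.ofReal c * luxNorm μ B f := by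
  have hc0 : ENNReal.ofReal c ≠ 0 := by simpa using hc
  rw [mul_comm, ← ENNReal.div_le_iff_le_mul (Or.inl hc0) (Or.inl ENNReal.ofReal_ne_top)]
  refine le_sInf fun l hl => ?_
  rw [ENNReal.div_le_iff_le_mul (Or.inl hc0) (Or.inl ENNReal.ofReal_ne_top), mul_comm]
  refine sInf_le ⟨ENNReal.mul_pos hc0 hl.1.ne', le_of_eq_of_le ?_ hl.2⟩
  simp only [ofReal_abs_const_mul hc.le, ENNReal.mul_div_mul_left _ _ hc0 ENNReal.ofReal_ne_top]

lemma luxNorm_le_of_lintegral_le {B : YoungFunction} {f : R → ℝ} {l : ℝ≥0∞} (hl : 0 < l)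
    (h : ∫⁻ x, B.toFun (ENNReal.ofReal |f x| / l) ∂μ ≤ 1) : luxNorm μ B f ≤ l :=
  sInf_le ⟨hl, h⟩

lemma lintegral_le_one_of_luxNorm_lt {B : YoungFunction} {f : R → ℝ} {l : ℝ≥0∞}
    (h : luxNorm μ B f < l) : ∫⁻ x, B.toFun (ENNReal.ofReal |f x| / l) ∂μ ≤ 1 := by
  obtain ⟨k, hk, hkl⟩ := sInf_lt_iff.1 h
  refine le_trans (lintegral_mono fun x => B.mono ?_) hk.2
  gcongr

lemma luxNorm_le_of_indicator_lt {B : YoungFunction} {f : R → ℝ} {l : ℝ≥0∞} {E : Set R}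
    (hE : MeasurableSet E) (h1 : luxNorm μ B (E.indicator f) < l)
    (h2 : luxNorm μ B (Eᶜ.indicator f) < l) : luxNorm μ B f ≤ 2 * l := by
  have hhalf : ∀ S : Set R, MeasurableSet S → luxNorm μ B (S.indicator f) < l →
      2 * ∫⁻ x in S, B.toFun (ENNReal.ofReal |f x| / (2 * l)) ∂μ ≤ 1 := by
    intro S hS h
    rw [← lintegral_const_mul' _ _ (by simp)]
    calc ∫⁻ x in S, 2 * B.toFun (ENNReal.ofReal |f x| / (2 * l)) ∂μ
        ≤ ∫⁻ x in S, B.toFun (ENNReal.ofReal |S.indicator f x| / l) ∂μ := by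
          refine setLIntegral_mono' hS fun x hx => ?_
          rw [indicator_of_mem hx]
          refine (B.two_mul_le _).trans_eq ?_
          rw [← mul_div_assoc, ENNReal.mul_div_mul_left _ _ (by simp) (by simp)]
      _ ≤ ∫⁻ x, B.toFun (ENNReal.ofReal |S.indicator f x| / l) ∂μ := setLIntegral_le_lintegral _ _
      _ ≤ 1 := lintegral_le_one_of_luxNorm_lt h
  refine luxNorm_le_of_lintegral_le (ENNReal.mul_pos (by simp) (zero_le.trans_lt h1).ne') ?_
  rw [← lintegral_add_compl _ hE]
  have h3 := add_le_add (hhalf E hE h1) (hhalf Eᶜ hE.compl h2)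
  rw [← mul_add, one_add_one_eq_two] at h3
  refine (ENNReal.mul_le_mul_iff_right (a := 2) (by simp) (by simp)).1 ?_
  rwa [mul_one]

end Luxemburg

section Embedding

variable {μ : Measure R}

/-- Almost-compact embeddings are uniformly absolutely continuous. -/
lemma AlmostCompactEmbedding.exists_pos_forall_measure_le {NX NY : (R → ℝ) → ℝ≥0∞}
    (h : AlmostCompactEmbedding μ NX NY) :
    ∃ δ : ℝ≥0∞, 0 < δ ∧ ∀ E : Set R, MeasurableSet E → μ E ≤ δ →
      ∀ f : R → ℝ, Measurable f → NX f ≤ 1 → NY (E.indicator f) ≤ 1 := by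
  by_contra! hcon
  have hpos : ∀ n : ℕ, 0 < (2⁻¹ : ℝ≥0∞) ^ n := fun n => ENNReal.pow_pos (by simp) n
  choose E hE hEle f hf hf1 hlt using fun n => hcon _ (hpos n)
  have hsum : ∑' n, μ (E n) ≠ ⊤ := by
    refine ne_top_of_le_ne_top ?_ (ENNReal.tsum_le_tsum hEle)
    rw [ENNReal.tsum_geometric, ENNReal.one_sub_inv_two, inv_inv]
    simp
  have hlim := h.2 E hE (by
    filter_upwards [ae_eventually_notMem hsum] with x hx
    refine tendsto_const_nhds.congr' ?_
    filter_upwards [hx] with n hn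
    rw [indicator_of_notMem hn])
  obtain ⟨n, hn⟩ := (hlim.eventually_lt_const zero_lt_one).exists
  exact absurd (hlt n) (not_lt.2 (le_trans
    (le_iSup (fun f : {f : R → ℝ // Measurable f ∧ NX f ≤ 1} => NY ((E n).indicator f.1))
      ⟨f n, hf n, hf1 n⟩) hn.le))

lemma luxNorm_indicator_compl_le {B : YoungFunction} {δ c : ℝ≥0∞} (hδ : 0 < δ) (hδt : δ ≠ ⊤)
    (hc : 0 < c) (hct : c ≠ ⊤) (hB : B.toFun δ * μ univ ≤ 1) (f : R → ℝ) :
    luxNorm μ B ({x | c < ENNReal.ofReal |f x|}ᶜ.indicator f) ≤ c / δ := by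
  refine luxNorm_le_of_lintegral_le (ENNReal.div_pos hc.ne' hδt) ?_
  refine le_trans (lintegral_mono fun x => B.mono (b := δ) ?_) (by rwa [lintegral_const])
  rw [ENNReal.div_le_iff_le_mul (Or.inl (ENNReal.div_pos hc.ne' hδt).ne')
    (Or.inl (ENNReal.div_ne_top hct hδ.ne')), ENNReal.mul_div_cancel hδ.ne' hδt]
  by_cases hx : x ∈ {x | c < ENNReal.ofReal |f x|}ᶜ
  · rw [indicator_of_mem hx]
    exact not_lt.1 hx
  · simp [indicator_of_notMem hx]

lemma normEmbedding_of_bounded {B : YoungFunction} {p q M : ℝ≥0∞} (hq : q ≠ 0) (hM : M ≠ ⊤)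
    (h : ∀ f : R → ℝ, Measurable f → lorentzNorm μ p q f ≤ 1 → luxNorm μ B f ≤ M) :
    NormEmbedding μ (lorentzNorm μ p q) (luxNorm μ B) := by
  set C : ℝ := M.toReal + 1 with hC
  have hC0 : 0 < C := by positivity
  have hMC : M ≤ ENNReal.ofReal C := by
    rw [← ENNReal.ofReal_toReal hM]
    exact ENNReal.ofReal_le_ofReal (by linarith)
  refine ⟨C, hC0, fun f hf => ?_⟩
  rcases eq_or_ne (lorentzNorm μ p q f) ⊤ with htop | htop
  · rw [htop, ENNReal.mul_top (by simpa using hC0)]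
    exact le_top
  refine ENNReal.le_of_forall_pos_le_add fun ε hε _ => ?_
  set v := (lorentzNorm μ p q f).toReal with hv
  have hfv : lorentzNorm μ p q f = ENNReal.ofReal v := (ENNReal.ofReal_toReal htop).symm
  have hv0 : 0 ≤ v := ENNReal.toReal_nonneg
  set w : ℝ := v + ε / C with hw
  have hw0 : 0 < w := by positivity
  have hball : lorentzNorm μ p q (fun x => w⁻¹ * f x) ≤ 1 := by
    refine (lorentzNorm_const_mul_le hq (inv_pos.2 hw0)).trans ?_
    rw [hfv, ← ENNReal.ofReal_mul (by positivity), ENNReal.ofReal_le_one, inv_mul_le_iff₀ hw0]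
    have : 0 ≤ (ε : ℝ) / C := by positivity
    linarith
  have hff : f = fun x => w * (w⁻¹ * f x) := by
    ext x
    rw [mul_inv_cancel_left₀ hw0.ne']
  calc luxNorm μ B f ≤ ENNReal.ofReal w * luxNorm μ B (fun x => w⁻¹ * f x) := by
        nth_rewrite 1 [hff]
        exact luxNorm_const_mul_le hw0
    _ ≤ ENNReal.ofReal w * ENNReal.ofReal C := by
        gcongr
        exact (h _ (hf.const_mul _) hball).trans hMC
    _ = ENNReal.ofReal C * lorentzNorm μ p q f + ε := by
        rw [hfv, ← ENNReal.ofReal_mul hw0.le, ← ENNReal.ofReal_mul hC0.le,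
          ← ENNReal.ofReal_coe_nnreal, ← ENNReal.ofReal_add (by positivity) (by positivity), hw]
        congr 1
        field_simp

lemma AlmostCompactEmbedding.normEmbedding [IsFiniteMeasure μ] {B : YoungFunction} {r : ℝ}
    {s : ℝ≥0∞} (hr : 1 < r) (hrs : ENNReal.ofReal r < s)
    (h : AlmostCompactEmbedding μ (lorentzNorm μ (ENNReal.ofReal r) s) (luxNorm μ B)) :
    NormEmbedding μ (lorentzNorm μ (ENNReal.ofReal r) s) (luxNorm μ B) := by
  have hr0 : 0 < r := by linarith
  have hs0 : s ≠ 0 := (zero_le.trans_lt hrs).ne'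
  obtain ⟨δ, hδ, hδE⟩ := h.exists_pos_forall_measure_le
  obtain ⟨η, hη, hηt, hBη⟩ := B.exists_pos_mul_le_one (measure_ne_top μ univ)
  obtain ⟨C, hC, hCf⟩ := ellSize_levelSeq_le (μ := μ) hr hrs
  obtain ⟨n, hn⟩ := ENNReal.exists_nat_mul_gt hδ.ne' hC
  have hpn : ((2 : ℝ≥0∞) ^ n) ^ r ≠ 0 ∧ ((2 : ℝ≥0∞) ^ n) ^ r ≠ ⊤ :=
    ⟨by simp [ENNReal.rpow_eq_zero_iff], ENNReal.rpow_ne_top_of_nonneg hr0.le (by finiteness)⟩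
  have hp0 : s / ENNReal.ofReal r ≠ 0 := (ENNReal.div_pos hs0 ENNReal.ofReal_ne_top).ne'
  have hn2 : (n : ℝ≥0∞) ≤ ((2 : ℝ≥0∞) ^ n) ^ r := by
    calc (n : ℝ≥0∞) ≤ (2 : ℝ≥0∞) ^ n := by exact_mod_cast Nat.lt_two_pow_self.le
      _ = ((2 : ℝ≥0∞) ^ n) ^ (1 : ℝ) := (ENNReal.rpow_one _).symm
      _ ≤ _ := ENNReal.rpow_le_rpow_of_exponent_le (one_le_pow₀ (by norm_num)) hr.le
  have hfin : (2 : ℝ≥0∞) ^ n / η ≠ ⊤ := ENNReal.div_ne_top (by simp) hη.ne'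
  refine normEmbedding_of_bounded (M := 2 * (2 + 2 ^ n / η)) hs0 (by finiteness) fun f hf hf1 => ?_
  have hE : MeasurableSet {x | (2 : ℝ≥0∞) ^ n < ENNReal.ofReal |f x|} :=
    measurableSet_lt measurable_const hf.abs.ennreal_ofReal
  have hμE : μ {x | (2 : ℝ≥0∞) ^ n < ENNReal.ofReal |f x|} ≤ δ := by
    have h1 : levelSeq μ r f n ≤ C := by
      refine (ellSize_apply_le hp0 _ n).trans ((hCf f).trans ?_)
      calc C * lorentzNorm μ (ENNReal.ofReal r) s f ^ r ≤ C * 1 ^ r := by gcongr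
        _ = C := by simp
    rw [← ENNReal.mul_le_mul_iff_right hpn.1 hpn.2]
    calc _ ≤ C := h1
      _ ≤ n * δ := hn.le
      _ ≤ _ := by gcongr
  refine luxNorm_le_of_indicator_lt hE ?_ ?_
  · refine (hδE _ hE hμE f hf hf1).trans_lt
      (lt_of_lt_of_le (b := (2 : ℝ≥0∞)) (by norm_num) le_self_add)
  · refine (luxNorm_indicator_compl_le hη hηt (by positivity) (by simp) hBη f).trans_lt ?_
    rw [add_comm]
    exact ENNReal.lt_add_right hfin (by simp)

end Embedding

section Pairing

variable {μ : Measure R}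

lemma YoungFunction.two_mul_two_pow_le (B : YoungFunction) (j : ℕ) :
    2 * B.toFun (2 ^ j) ≤ B.toFun (2 ^ (j + 1)) := by
  rw [pow_succ']
  exact B.two_mul_le _

lemma tsum_mul_measure_le_two_mul_lintegral_dyadicSum {B : YoungFunction} {F : ℕ → Set R}
    (hF : ∀ j, MeasurableSet (F j)) {N : ℕ} {m : ℕ → ℝ≥0∞} (hm : ∀ j, N ≤ j → m j = 0)
    (hmF : ∀ j, m j ≤ μ (F j)) :
    ∑' j, B.toFun (2 ^ j) * m j ≤ 2 * ∫⁻ x, B.toFun (ENNReal.ofReal |dyadicSum F N x|) ∂μ := by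
  classical
  calc ∑' j, B.toFun (2 ^ j) * m j
      ≤ ∑' j, ∫⁻ x, (if j < N ∧ x ∈ F j then B.toFun (2 ^ j) else 0) ∂μ := by
        refine ENNReal.tsum_le_tsum fun j => ?_
        by_cases hj : j < N
        · have : (fun x => if j < N ∧ x ∈ F j then B.toFun (2 ^ j) else 0) =
              (F j).indicator fun _ => B.toFun (2 ^ j) := by
            ext x
            simp [hj, indicator_apply]
          rw [this, lintegral_indicator_const (hF j)]
          gcongr
          exact hmF j
        · simp [hm j (not_lt.1 hj)]
    _ = ∫⁻ x, ∑' j, (if j < N ∧ x ∈ F j then B.toFun (2 ^ j) else 0) ∂μ := by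
        refine (lintegral_tsum fun j => ?_).symm
        exact (Measurable.ite ((MeasurableSet.const _).inter (hF j)) measurable_const
          measurable_const).aemeasurable
    _ ≤ ∫⁻ x, 2 * B.toFun (ENNReal.ofReal |dyadicSum F N x|) ∂μ := by
        refine lintegral_mono fun x => tsum_ite_le_two_mul B.two_mul_two_pow_le _ fun j hj => ?_
        refine B.mono ?_
        rw [abs_of_nonneg (dyadicSum_nonneg F N x)]
        refine le_of_eq_of_le ?_ (ENNReal.ofReal_le_ofReal (two_pow_le_dyadicSum hj.1 hj.2))
        rw [ENNReal.ofReal_pow (by norm_num), ENNReal.ofReal_ofNat]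
    _ = _ := lintegral_const_mul' _ _ (by simp)

/-- If `L^{r,s}` embeds into `L^B`, then `j ↦ B(2^j) / 2^{jr}` is a bounded functional on
finitely supported sequences with respect to `ellSize (s / r)`. -/
lemma NormEmbedding.exists_pairing_le [IsFiniteMeasure μ] (hna : NonAtomic μ)
    (hpos : 0 < μ univ) {B : YoungFunction} {r : ℝ} {s : ℝ≥0∞} (hr : 1 < r)
    (hrs : ENNReal.ofReal r < s)
    (h : NormEmbedding μ (lorentzNorm μ (ENNReal.ofReal r) s) (luxNorm μ B)) :
    ∃ c : ℝ≥0∞, c ≠ 0 ∧ c ≠ ⊤ ∧ ∀ (N : ℕ) (a : ℕ → ℝ≥0∞), (∀ j, N ≤ j → a j = 0) →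
      ellSize (s / ENNReal.ofReal r) a ≤ c →
      ∑' j, B.toFun (2 ^ j) / ((2 : ℝ≥0∞) ^ j) ^ r * a j ≤ 2 := by
  have hr0 : 0 < r := by linarith
  have hs0 : s ≠ 0 := (zero_le.trans_lt hrs).ne'
  have hp0 : s / ENNReal.ofReal r ≠ 0 := (ENNReal.div_pos hs0 ENNReal.ofReal_ne_top).ne'
  obtain ⟨C, hC0, hC⟩ := h
  obtain ⟨K, hK, hKF⟩ := lorentzNorm_dyadicSum_le (μ := μ) hr hrs
  set D : ℝ≥0∞ := ENNReal.ofReal (1 / (2 * C)) with hD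
  have hD0 : D ≠ 0 := by
    rw [hD, ne_eq, ENNReal.ofReal_eq_zero, not_le]
    positivity
  have hDr : D ^ r ≠ 0 := by
    exact (ENNReal.rpow_pos (pos_iff_ne_zero.2 hD0) ENNReal.ofReal_ne_top).ne'
  have hK1 : K + 1 ≠ ⊤ := by finiteness
  have hKD : K * (D ^ r / (K + 1)) ≤ D ^ r := by
    calc K * (D ^ r / (K + 1)) ≤ (K + 1) * (D ^ r / (K + 1)) := by gcongr; exact le_self_add
      _ = D ^ r := ENNReal.mul_div_cancel (by simp) hK1
  refine ⟨min (μ univ) (D ^ r / (K + 1)), ?_, ?_, fun N a haN hac => ?_⟩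
  · exact (lt_min hpos (ENNReal.div_pos hDr hK1)).ne'
  · exact ne_top_of_le_ne_top (measure_ne_top μ univ) (min_le_left _ _)
  have hw1 : ∀ j : ℕ, (1 : ℝ≥0∞) ≤ ((2 : ℝ≥0∞) ^ j) ^ r := fun j =>
    ENNReal.one_le_rpow (one_le_pow₀ (by norm_num)) hr0
  have hwt : ∀ j : ℕ, ((2 : ℝ≥0∞) ^ j) ^ r ≠ ⊤ := fun j =>
    ENNReal.rpow_ne_top_of_nonneg hr0.le (by finiteness)
  set m : ℕ → ℝ≥0∞ := fun j => a j / ((2 : ℝ≥0∞) ^ j) ^ r with hmdef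
  have hma : ∀ j, ((2 : ℝ≥0∞) ^ j) ^ r * m j = a j := fun j =>
    ENNReal.mul_div_cancel (zero_lt_one.trans_le (hw1 j)).ne' (hwt j)
  have hmu : ∀ j, m j ≤ μ univ := fun j =>
    calc m j ≤ a j / 1 := ENNReal.div_le_div_left (hw1 j) _
      _ = a j := div_one _
      _ ≤ _ := (ellSize_apply_le hp0 a j).trans (hac.trans (min_le_left _ _))
  have hmN : ∀ j, N ≤ j → m j = 0 := fun j hj => by simp [hmdef, haN j hj]
  obtain ⟨F, hFa, hF⟩ := hna.exists_antitone_measure_eq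
    (M := fun j => ⨆ i, ⨆ (_ : j ≤ i), m i)
    (fun j k hjk => iSup₂_le fun i hi => le_iSup₂ (f := fun i (_ : j ≤ i) => m i) i (hjk.trans hi))
    (iSup₂_le fun i _ => hmu i)
  have hlor : lorentzNorm μ (ENNReal.ofReal r) s (dyadicSum F N) ≤ D := by
    rw [← ENNReal.rpow_le_rpow_iff hr0]
    refine (hKF F N m hFa hmN (fun j => ne_top_of_le_ne_top (measure_ne_top μ _) (hmu j))
      fun j => (hF j).2).trans ?_
    simp only [hma]
    refine le_trans ?_ hKD
    gcongr
    exact hac.trans (min_le_right _ _)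
  have hlux : luxNorm μ B (dyadicSum F N) < 1 := by
    refine (hC _ (measurable_dyadicSum (fun j => (hF j).1) N)).trans_lt ?_
    calc ENNReal.ofReal C * _ ≤ ENNReal.ofReal C * D := by gcongr
      _ = ENNReal.ofReal (1 / 2) := by
        rw [hD, ← ENNReal.ofReal_mul hC0.le]
        congr 1
        field_simp
      _ < 1 := by rw [ENNReal.ofReal_lt_one]; norm_num
  have hint := lintegral_le_one_of_luxNorm_lt hlux
  simp only [div_one] at hint
  calc ∑' j, B.toFun (2 ^ j) / ((2 : ℝ≥0∞) ^ j) ^ r * a j = ∑' j, B.toFun (2 ^ j) * m j := by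
        refine tsum_congr fun j => ?_
        simp only [hmdef, div_eq_mul_inv]
        ring
    _ ≤ 2 * ∫⁻ x, B.toFun (ENNReal.ofReal |dyadicSum F N x|) ∂μ :=
        tsum_mul_measure_le_two_mul_lintegral_dyadicSum (fun j => (hF j).1) hmN fun j => by
          rw [(hF j).2]
          exact le_iSup₂ (f := fun i (_ : j ≤ i) => m i) j le_rfl
    _ ≤ 2 * 1 := by gcongr
    _ = 2 := mul_one _

end Pairing

section AlmostCompact

variable {μ : Measure R}

lemma tendsto_measure_zero_of_ae_tendsto_indicator [IsFiniteMeasure μ] {E : ℕ → Set R}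
    (hE : ∀ n, MeasurableSet (E n))
    (h : ∀ᵐ x ∂μ, Tendsto (fun n => (E n).indicator (fun _ => (1 : ℝ)) x) atTop (nhds 0)) :
    Tendsto (fun n => μ (E n)) atTop (nhds 0) := by
  rw [← measure_empty (μ := μ)]
  refine tendsto_measure_of_ae_tendsto_indicator_of_isFiniteMeasure atTop MeasurableSet.empty
    hE ?_
  filter_upwards [h] with x hx
  filter_upwards [hx.eventually_lt_const zero_lt_one] with n hn
  refine iff_of_false (fun hxn => ?_) (notMem_empty x)
  rw [indicator_of_mem hxn] at hn
  exact lt_irrefl _ hn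

/-- Dyadic layers dominate `B` above the level `2^J`. -/
lemma YoungFunction.apply_half_le_add_tsum (B : YoungFunction) (J : ℕ) {y : ℝ≥0∞} (hy : y ≠ ⊤) :
    B.toFun (y / 2) ≤
      B.toFun (2 ^ J) + ∑' j, if 2 ^ (j + J) < y then B.toFun (2 ^ (j + J)) else 0 := by
  have hex : ∃ k : ℕ, y ≤ 2 ^ (k + J) := by
    obtain ⟨n, hn⟩ := ENNReal.exists_nat_gt hy
    refine ⟨n, hn.le.trans ?_⟩
    calc (n : ℝ≥0∞) ≤ 2 ^ n := by exact_mod_cast Nat.lt_two_pow_self.le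
      _ ≤ 2 ^ (n + J) := pow_le_pow_right₀ (by norm_num) (by omega)
  have hspec := Nat.find_spec hex
  rcases hk : Nat.find hex with _ | j
  · rw [hk, zero_add] at hspec
    exact (B.mono (ENNReal.half_le_self.trans hspec)).trans le_self_add
  · have hlt : 2 ^ (j + J) < y := not_le.1 (Nat.find_min hex (by omega))
    rw [hk] at hspec
    calc B.toFun (y / 2) ≤ B.toFun (2 ^ (j + J)) := by
          refine B.mono (ENNReal.div_le_of_le_mul (hspec.trans_eq ?_))
          rw [← pow_succ]
          congr 1
          omega
      _ = if 2 ^ (j + J) < y then B.toFun (2 ^ (j + J)) else 0 := (if_pos hlt).symm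
      _ ≤ _ := ENNReal.le_tsum
        (f := fun j => if 2 ^ (j + J) < y then B.toFun (2 ^ (j + J)) else 0) j
      _ ≤ _ := le_add_self

lemma lintegral_indicator_half_le {B : YoungFunction} {u : R → ℝ} (hu : Measurable u) {E : Set R}
    (hE : MeasurableSet E) (J : ℕ) :
    ∫⁻ x, B.toFun (ENNReal.ofReal |E.indicator u x| / 2) ∂μ ≤
      B.toFun (2 ^ J) * μ E + ∑' j, B.toFun (2 ^ (j + J)) * distFn μ u (2 ^ (j + J)) := by
  have hmeas : ∀ j : ℕ, MeasurableSet {x | (2 : ℝ≥0∞) ^ (j + J) < ENNReal.ofReal |u x|} :=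
    fun j => measurableSet_lt measurable_const hu.abs.ennreal_ofReal
  calc ∫⁻ x, B.toFun (ENNReal.ofReal |E.indicator u x| / 2) ∂μ
      ≤ ∫⁻ x, E.indicator (fun _ => B.toFun (2 ^ J)) x +
          ∑' j, {x | (2 : ℝ≥0∞) ^ (j + J) < ENNReal.ofReal |u x|}.indicator
            (fun _ => B.toFun (2 ^ (j + J))) x ∂μ := by
        refine lintegral_mono fun x => ?_
        by_cases hx : x ∈ E
        · simp only [indicator_of_mem hx]
          simpa only [indicator_apply, mem_ofPred_eq] using
            B.apply_half_le_add_tsum J (y := ENNReal.ofReal |u x|) ENNReal.ofReal_ne_top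
        · simp [indicator_of_notMem hx, B.map_zero]
    _ = _ := by
        rw [lintegral_add_left (measurable_const.indicator hE), lintegral_indicator_const hE,
          lintegral_tsum fun j => (measurable_const.indicator (hmeas j)).aemeasurable]
        simp only [lintegral_indicator_const (hmeas _), distFn]

lemma NormEmbedding.almostCompactEmbedding [IsFiniteMeasure μ] (hna : NonAtomic μ)
    (hpos : 0 < μ univ) {B : YoungFunction} {r : ℝ} {s : ℝ≥0∞} (hr : 1 < r)
    (hrs : ENNReal.ofReal r < s)
    (h : NormEmbedding μ (lorentzNorm μ (ENNReal.ofReal r) s) (luxNorm μ B)) :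
    AlmostCompactEmbedding μ (lorentzNorm μ (ENNReal.ofReal r) s) (luxNorm μ B) := by
  have hr0 : 0 < r := by linarith
  have hs0 : s ≠ 0 := (zero_le.trans_lt hrs).ne'
  have hp1 : 1 < s / ENNReal.ofReal r := by
    rwa [ENNReal.lt_div_iff_mul_lt (Or.inl (by simpa using hr0)) (Or.inl ENNReal.ofReal_ne_top),
      one_mul]
  have hw0 : ∀ j : ℕ, ((2 : ℝ≥0∞) ^ j) ^ r ≠ 0 := fun j => by
    simp [ENNReal.rpow_eq_zero_iff]
  have hwt : ∀ j : ℕ, ((2 : ℝ≥0∞) ^ j) ^ r ≠ ⊤ := fun j =>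
    ENNReal.rpow_ne_top_of_nonneg hr0.le (by finiteness)
  obtain ⟨c, hc0, hct, hβ⟩ := h.exists_pairing_le hna hpos hr hrs
  obtain ⟨C₁, hC₁, hlevel⟩ := ellSize_levelSeq_le (μ := μ) hr hrs
  obtain ⟨C, hC0, hC⟩ := h
  refine ⟨fun f hf hfin => (hC f hf).trans_lt (ENNReal.mul_lt_top ENNReal.ofReal_lt_top hfin),
    fun E hE hlim => ENNReal.tendsto_nhds_zero.2 fun ε hε => ?_⟩
  obtain ⟨θ, hθ, hθε⟩ : ∃ θ : ℝ, 0 < θ ∧ ENNReal.ofReal θ ≤ ε := by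
    obtain ⟨q, hq0, hqε⟩ := ENNReal.lt_iff_exists_nnreal_btwn.1 hε
    exact ⟨q, by exact_mod_cast hq0, by simpa using hqε.le⟩
  have hθ2 : 0 < 2 / θ := by positivity
  obtain ⟨J, hJ⟩ := exists_tail_pairing_le hp1 hc0 hct (by simp) hβ
    (L := C₁ * ENNReal.ofReal (2 / θ) ^ r) (ε := 2⁻¹)
    (ENNReal.mul_ne_top hC₁ (ENNReal.rpow_ne_top_of_nonneg hr0.le ENNReal.ofReal_ne_top))
    (by simp)
  have hBJ : B.toFun (2 ^ J) ≠ ⊤ := fun htop =>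
    ne_top_of_pairing_bounded (zero_lt_one.trans hp1).ne' hc0 (by simp) hβ J
      (by rw [htop, ENNReal.top_div_of_ne_top (hwt J)])
  have hsmall := ENNReal.Tendsto.const_mul (a := B.toFun (2 ^ J))
    (tendsto_measure_zero_of_ae_tendsto_indicator hE hlim) (Or.inr hBJ)
  rw [mul_zero] at hsmall
  filter_upwards [hsmall.eventually_le_const (u := 2⁻¹) (by simp)] with n hn
  refine iSup_le fun ⟨f, hf, hf1⟩ => le_trans ?_ hθε
  refine luxNorm_le_of_lintegral_le (ENNReal.ofReal_pos.2 hθ) ?_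
  set u : R → ℝ := fun x => 2 / θ * f x with hu
  have hul : ellSize (s / ENNReal.ofReal r) (levelSeq μ r u) ≤
      C₁ * ENNReal.ofReal (2 / θ) ^ r := by
    refine (hlevel u).trans ?_
    gcongr
    calc lorentzNorm μ (ENNReal.ofReal r) s u
        ≤ ENNReal.ofReal (2 / θ) * lorentzNorm μ (ENNReal.ofReal r) s f :=
          lorentzNorm_const_mul_le hs0 hθ2
      _ ≤ ENNReal.ofReal (2 / θ) * 1 := by gcongr
      _ = _ := mul_one _
  have htail : ∑' j, B.toFun (2 ^ (j + J)) * distFn μ u (2 ^ (j + J)) ≤ 2⁻¹ := by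
    refine le_of_eq_of_le (tsum_congr fun j => ?_) (hJ _ hul)
    rw [levelSeq, ← mul_assoc, ENNReal.div_mul_cancel (hw0 _) (hwt _)]
  have hpt : ∀ x, ENNReal.ofReal |(E n).indicator f x| / ENNReal.ofReal θ =
      ENNReal.ofReal |(E n).indicator u x| / 2 := fun x => by
    have hind : (E n).indicator u x = 2 / θ * (E n).indicator f x := by
      by_cases hx : x ∈ E n <;> simp [hu, hx]
    rw [hind, ofReal_abs_const_mul hθ2.le, ENNReal.ofReal_div_of_pos hθ, ENNReal.ofReal_ofNat,
      div_eq_mul_inv, div_eq_mul_inv, div_eq_mul_inv, mul_comm (2 * _), mul_assoc,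
      mul_assoc, mul_comm _ (2⁻¹ : ℝ≥0∞), ← mul_assoc 2, ENNReal.mul_inv_cancel (by simp) (by simp),
      one_mul]
  calc ∫⁻ x, B.toFun (ENNReal.ofReal |(E n).indicator f x| / ENNReal.ofReal θ) ∂μ
      = ∫⁻ x, B.toFun (ENNReal.ofReal |(E n).indicator u x| / 2) ∂μ := by simp only [hpt]
    _ ≤ 2⁻¹ + 2⁻¹ := (lintegral_indicator_half_le (hf.const_mul _) (hE n) J).trans
        (add_le_add hn htail)
    _ = 1 := ENNReal.inv_two_add_inv_two

end AlmostCompact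

/-- On a non-atomic finite measure space of positive measure,
for a Young function `B` and `1 < r < s ≤ ∞`, the continuous embedding
`L^{r,s} ↪ L^B` holds iff the almost-compact embedding `L^{r,s} ↪* L^B` holds. -/
theorem lorentz_orlicz_embedding_iff_almost_compact
    {R : Type*} [MeasurableSpace R] (μ : Measure R)
    (hna : NonAtomic μ) (hpos : 0 < μ Set.univ) (hfin : μ Set.univ < ⊤)
    (B : YoungFunction) (r : ℝ) (s : ℝ≥0∞) (hr : 1 < r) (hrs : ENNReal.ofReal r < s) :
    NormEmbedding μ (lorentzNorm μ (ENNReal.ofReal r) s) (luxNorm μ B) ↔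
      AlmostCompactEmbedding μ (lorentzNorm μ (ENNReal.ofReal r) s) (luxNorm μ B) := by
  have : IsFiniteMeasure μ := ⟨hfin⟩
  exact ⟨fun h => h.almostCompactEmbedding hna hpos hr hrs, fun h => h.normEmbedding hr hrs⟩
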